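/- Let φ : ℝ → ℝ be defined by φ(t) := inf_{k ∈ ℕ, k ≥ 1} |t − 1/k|. Then both one-sided derivatives of φ at 0 exist: lim_{t↓0} φ(t)/t = 0 and lim_{t↓0} φ(−t)/t = 1. In particular the Dini directional derivatives φ'(0; 1) = 0 and φ'(0; −1) = 1 exist and satisfy max{|φ'(0;1)|, |φ'(0;−1)|} ≤ 1. -/

import Mathlib

open Filter Topology

/-- `φ(t) := inf_{k ∈ ℕ, k ≥ 1} |t - 1/k|`. -/
noncomputable def phiInf (t : ℝ) : ℝ :=
  ⨅ k : ℕ+, |t - 1 / (k : ℝ)|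

/-- `f : ℝ → ℝ` has Dini directional derivative `d` at `x` in direction `l`. -/
def HasDiniDerivAt1 (f : ℝ → ℝ) (x l d : ℝ) : Prop :=
  Tendsto (fun t : ℝ => (f (x + t * l) - f x) / t) (𝓝[>] 0) (𝓝 d)

theorem phiInf_nonneg (t : ℝ) : 0 ≤ phiInf t :=
  Real.iInf_nonneg fun _ => abs_nonneg _

theorem phiInf_le (t : ℝ) (k : ℕ+) : phiInf t ≤ |t - 1 / (k : ℝ)| :=
  ciInf_le ⟨0, by rintro _ ⟨_, rfl⟩; exact abs_nonneg _⟩ k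

theorem phiInf_le_sq {t : ℝ} (ht : 0 < t) : phiInf t ≤ t ^ 2 := by
  have hk : 0 < ⌈1 / t⌉₊ := Nat.ceil_pos.mpr (by positivity)
  refine (phiInf_le t ⟨⌈1 / t⌉₊, hk⟩).trans ?_
  have h1 : 1 / t ≤ (⌈1 / t⌉₊ : ℝ) := Nat.le_ceil _
  have h2 : (⌈1 / t⌉₊ : ℝ) < 1 / t + 1 := Nat.ceil_lt_add_one (by positivity)
  have hk' : (0 : ℝ) < ⌈1 / t⌉₊ := by exact_mod_cast hk
  simp only [PNat.mk_coe]
  generalize (⌈1 / t⌉₊ : ℝ) = k at *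
  have h3 : 1 ≤ k * t := (div_le_iff₀ ht).mp h1
  have h4 : k * t < 1 + t := by
    calc k * t < (1 / t + 1) * t := by gcongr
      _ = 1 + t := by field_simp
  have h5 : t - 1 / k = (k * t - 1) / k := by field_simp
  rw [h5, abs_of_nonneg (div_nonneg (by linarith) hk'.le), div_le_iff₀ hk']
  nlinarith

theorem phiInf_neg {t : ℝ} (ht : 0 ≤ t) : phiInf (-t) = t := by
  have habs (k : ℕ+) : |-t - 1 / (k : ℝ)| = t + 1 / (k : ℝ) := by
    have : (0 : ℝ) ≤ 1 / (k : ℝ) := by positivity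
    rw [abs_of_nonpos (by linarith)]
    ring
  refine le_antisymm (le_of_forall_pos_le_add fun ε hε => ?_) (le_ciInf fun k => ?_)
  · obtain ⟨n, hn⟩ := exists_nat_one_div_lt hε
    have h := phiInf_le (-t) n.succPNat
    rw [habs, Nat.succPNat_coe, Nat.cast_succ] at h
    linarith
  · rw [habs]
    have : (0 : ℝ) ≤ 1 / (k : ℝ) := by positivity
    linarith

theorem phiInf_zero : phiInf 0 = 0 := by
  simpa using phiInf_neg le_rfl

theorem tendsto_phiInf_div : Tendsto (fun t : ℝ => phiInf t / t) (𝓝[>] 0) (𝓝 0) := by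
  refine tendsto_of_tendsto_of_tendsto_of_le_of_le' tendsto_const_nhds
    (tendsto_id.mono_left nhdsWithin_le_nhds) ?_ ?_
  · filter_upwards [self_mem_nhdsWithin] with t (ht : 0 < t)
    exact div_nonneg (phiInf_nonneg t) ht.le
  · filter_upwards [self_mem_nhdsWithin] with t (ht : 0 < t)
    rw [div_le_iff₀ ht, id, ← sq]
    exact phiInf_le_sq ht

theorem tendsto_phiInf_neg_div :
    Tendsto (fun t : ℝ => phiInf (-t) / t) (𝓝[>] 0) (𝓝 1) := by
  refine tendsto_const_nhds.congr' ?_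
  filter_upwards [self_mem_nhdsWithin] with t (ht : 0 < t)
  rw [phiInf_neg ht.le, div_self (ne_of_gt ht)]

/-- One-sided derivatives of `φ(t) = inf_{k ≥ 1} |t - 1/k|` at `0`:
`lim_{t↓0} φ(t)/t = 0` and `lim_{t↓0} φ(-t)/t = 1`; in particular the Dini
directional derivatives are `φ'(0; 1) = 0` and `φ'(0; -1) = 1`. -/
theorem phiInf_one_sided_derivs :
    Tendsto (fun t : ℝ => phiInf t / t) (𝓝[>] 0) (𝓝 0) ∧
    Tendsto (fun t : ℝ => phiInf (-t) / t) (𝓝[>] 0) (𝓝 1) ∧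
    HasDiniDerivAt1 phiInf 0 1 0 ∧
    HasDiniDerivAt1 phiInf 0 (-1) 1 ∧
    max |(0 : ℝ)| |(1 : ℝ)| ≤ 1 := by
  refine ⟨tendsto_phiInf_div, tendsto_phiInf_neg_div, ?_, ?_, by simp⟩
  · simpa [HasDiniDerivAt1, phiInf_zero] using tendsto_phiInf_div
  · simpa [HasDiniDerivAt1, phiInf_zero] using tendsto_phiInf_neg_div
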